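/- Fix an integer D ≥ 3 and let (V, σ_0, …, σ_D) be a connected edge (D+1)-colored graph with V nonempty whose reduced degree is zero, i.e. the total number of faces F satisfies 4·F = 4·D + D·(D−1)·|V|. Then the graph contains two vertices joined by at least D parallel edges: there exist vertices v ≠ w such that the set of colors { i : σ_i(v) = w } has cardinality at least D. -/

import Mathlib

namespace ColoredGraph

open Equiv

/-- The functions `V → ℤ/2` invariant under every permutation of `S`. -/
def invariants {V : Type} (S : Set (Perm V)) : Submodule (ZMod 2) (V → ZMod 2) where
  carrier := {f | ∀ s ∈ S, ∀ x, f (s x) = f x}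
  add_mem' hf hg s hs x := by simp [hf s hs x, hg s hs x]
  zero_mem' _ _ _ := rfl
  smul_mem' a f hf s hs x := by simp [hf s hs x]

/-- The number of orbits of the group generated by `S`. -/
noncomputable def orbitCount {V : Type} (S : Set (Perm V)) : ℕ :=
  Nat.card (MulAction.orbitRel.Quotient (Subgroup.closure S) V)

theorem invariants_closure {V : Type} {S : Set (Perm V)} {f : V → ZMod 2}
    (hf : f ∈ invariants S) {s : Perm V} (hs : s ∈ Subgroup.closure S) (x : V) :
    f (s x) = f x := by
  induction hs using Subgroup.closure_induction generalizing x with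
  | mem s hs => exact hf s hs x
  | one => rfl
  | mul a b _ _ iha ihb => rw [Perm.mul_apply, iha, ihb]
  | inv a _ iha => rw [← iha]; simp

theorem closure_apply_of_forall {V : Type} {S : Set (Perm V)} {P : V → Prop}
    (hinv : ∀ s ∈ S, ∀ x, s (s x) = x) (hP : ∀ s ∈ S, ∀ x, P x → P (s x))
    {s : Perm V} (hs : s ∈ Subgroup.closure S) {x : V} (hx : P x) : P (s x) := by
  suffices h : P x ↔ P (s x) from h.1 hx
  clear hx
  induction hs using Subgroup.closure_induction generalizing x with
  | mem s hs => exact ⟨hP s hs x, fun h => hinv s hs x ▸ hP s hs _ h⟩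
  | one => rfl
  | mul a b _ _ iha ihb => rw [Perm.mul_apply, ← iha, ← ihb]
  | inv a _ iha => rw [iha (x := a⁻¹ x)]; simp

/-- Invariant functions are the functions on the set of orbits. -/
noncomputable def invariantsEquiv {V : Type} (S : Set (Perm V)) :
    invariants S ≃ₗ[ZMod 2]
      (MulAction.orbitRel.Quotient (Subgroup.closure S) V → ZMod 2) where
  toFun f q := Quotient.liftOn' q f.1 (by
    rintro a b ⟨⟨s, hs⟩, rfl⟩
    exact invariants_closure f.2 hs b)
  invFun F := ⟨fun x => F (Quotient.mk'' x), fun s hs x => congrArg F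
    (Quotient.sound' ⟨⟨s, Subgroup.subset_closure hs⟩, rfl⟩)⟩
  left_inv _ := rfl
  right_inv F := by
    ext q
    induction q using Quotient.inductionOn'
    rfl
  map_add' f g := by
    ext q
    induction q using Quotient.inductionOn'
    rfl
  map_smul' a f := by
    ext q
    induction q using Quotient.inductionOn'
    rfl

theorem finrank_invariants {V : Type} [Fintype V] (S : Set (Perm V)) :
    Module.finrank (ZMod 2) (invariants S) = orbitCount S := by
  classical
  have := Fintype.ofFinite (MulAction.orbitRel.Quotient (Subgroup.closure S) V)
  rw [(invariantsEquiv S).finrank_eq, Module.finrank_fintype_fun_eq_card, orbitCount,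
    Nat.card_eq_fintype_card]

theorem card_eq_sum_orbits {V : Type} [Fintype V] (S : Set (Perm V)) :
    ∃ (_ : Fintype (MulAction.orbitRel.Quotient (Subgroup.closure S) V)),
      Fintype.card V = ∑ q : MulAction.orbitRel.Quotient (Subgroup.closure S) V,
        Nat.card q.orbit := by
  classical
  have := Fintype.ofFinite (MulAction.orbitRel.Quotient (Subgroup.closure S) V)
  refine ⟨this, ?_⟩
  rw [← Nat.card_eq_fintype_card,
    Nat.card_congr (MulAction.selfEquivSigmaOrbits' (Subgroup.closure S) V), Nat.card_sigma]

theorem card_eq_two_mul_orbitCount {V : Type} [Fintype V] (s : Perm V)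
    (hinv : ∀ x, s (s x) = x) (hfpf : ∀ x, s x ≠ x) :
    Fintype.card V = 2 * orbitCount {s} := by
  obtain ⟨_, h⟩ := card_eq_sum_orbits ({s} : Set (Perm V))
  rw [h, orbitCount, Nat.card_eq_fintype_card, Finset.sum_const_nat (m := 2), mul_comm]
  · rfl
  intro q _
  induction q using Quotient.inductionOn' with | h x => ?_
  have : MulAction.orbitRel.Quotient.orbit
      (Quotient.mk'' x : MulAction.orbitRel.Quotient (Subgroup.closure {s}) V) = {x, s x} := by
    rw [MulAction.orbitRel.Quotient.orbit_mk]
    ext y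
    constructor
    · rintro ⟨⟨t, ht⟩, rfl⟩
      change t x ∈ _
      refine closure_apply_of_forall (P := fun y => y ∈ ({x, s x} : Set V)) ?_ ?_ ht (by simp)
      · rintro _ rfl
        exact hinv
      · rintro _ rfl y (rfl | rfl)
        · simp
        · simp [hinv]
    · rintro (rfl | rfl)
      · exact MulAction.mem_orbit_self _
      · exact ⟨⟨s, Subgroup.subset_closure rfl⟩, rfl⟩
  rw [this, Nat.card_coe_set_eq, Set.ncard_pair (hfpf x).symm]

theorem four_mul_orbitCount_le {V : Type} [Fintype V] (s t : Perm V)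
    (hs : ∀ x, s (s x) = x) (hsf : ∀ x, s x ≠ x) (htf : ∀ x, t x ≠ x)
    (hst : ∀ x, s x ≠ t x) :
    4 * orbitCount {s, t} ≤ Fintype.card V := by
  classical
  obtain ⟨_, h⟩ := card_eq_sum_orbits ({s, t} : Set (Perm V))
  rw [h, orbitCount, Nat.card_eq_fintype_card, mul_comm, ← smul_eq_mul, Fintype.card]
  refine Finset.card_nsmul_le_sum _ _ _ fun q _ => ?_
  induction q using Quotient.inductionOn' with | h x => ?_
  have hs' : s ∈ Subgroup.closure {s, t} := Subgroup.subset_closure (by simp)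
  have ht' : t ∈ Subgroup.closure {s, t} := Subgroup.subset_closure (by simp)
  have hsub : ((({x, s x, t x, s (t x)} : Finset V)) : Set V) ⊆ MulAction.orbitRel.Quotient.orbit
      (Quotient.mk'' x : MulAction.orbitRel.Quotient (Subgroup.closure {s, t}) V) := by
    rw [MulAction.orbitRel.Quotient.orbit_mk]
    intro y hy
    simp only [Finset.coe_insert, Finset.coe_singleton, Set.mem_insert_iff,
      Set.mem_singleton_iff] at hy
    rcases hy with rfl | rfl | rfl | rfl
    · exact MulAction.mem_orbit_self _
    · exact ⟨⟨s, hs'⟩, rfl⟩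
    · exact ⟨⟨t, ht'⟩, rfl⟩
    · exact ⟨⟨s * t, mul_mem hs' ht'⟩, rfl⟩
  have hcard : ({x, s x, t x, s (t x)} : Finset V).card = 4 := by
    have h1 : x ≠ s (t x) := fun h => hst x (by rw [← hs (t x), ← h])
    have h2 : s x ≠ s (t x) := fun h => htf x (s.injective h).symm
    rw [Finset.card_insert_of_notMem, Finset.card_insert_of_notMem, Finset.card_pair]
    · exact (hsf _).symm
    · simp [hst x, h2]
    · simp [h1, (hsf x).symm, (htf x).symm]
  rw [Nat.card_coe_set_eq, ← hcard, ← Set.ncard_coe_finset]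
  exact Set.ncard_le_ncard hsub (Set.toFinite _)


/-- The `σ k` are fixed-point-free involutions and generate a transitive group; transitivity is
stated as the absence of proper nonempty invariant sets. -/
structure IsConnectedColoring {V : Type} {n : ℕ} (σ : Fin n → Perm V) : Prop where
  invol : ∀ k x, σ k (σ k x) = x
  ne_self : ∀ k x, σ k x ≠ x
  conn : ∀ P : V → Prop, (∀ k x, P x → P (σ k x)) → ∀ x y, P x → P y

/-- The cellular complex with faces of the consecutive colors `(k, k+1)` has no homology in
degree one: a `ℤ/2`-cycle `h` of edges is the boundary of a set `g` of faces. -/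
def JacketAcyclic {V : Type} {D : ℕ} (τ : Fin (D + 1) → Perm V) : Prop :=
  ∀ h : Fin (D + 1) → V → ZMod 2, (∀ k x, h k (τ k x) = h k x) → (∀ x, ∑ k, h k x = 0) →
    ∃ g : Fin (D + 1) → V → ZMod 2, (∀ k x, g k (τ k x) = g k x) ∧
      (∀ k x, g k (τ (k + 1) x) = g k x) ∧ ∀ k x, h (k + 1) x = g (k + 1) x + g k x

/-- The boundary map from faces to edges. -/
def faceBoundary {V : Type} {D : ℕ} (τ : Fin (D + 1) → Perm V) :
    (∀ k, invariants {τ k, τ (k + 1)}) →ₗ[ZMod 2] (∀ k, invariants {τ k}) where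
  toFun g k := ⟨(g k).1 + (g (k - 1)).1, by
    rintro _ rfl x
    have h₁ := (g k).2 (τ k) (by simp) x
    have h₂ := (g (k - 1)).2 (τ k) (by simp) x
    simp [h₁, h₂]⟩
  map_add' f g := by
    ext k x
    simp only [Pi.add_apply, Submodule.coe_add]
    abel
  map_smul' a f := by
    ext k x
    simp [mul_add]

/-- The boundary map from edges to vertices. -/
def edgeBoundary {V : Type} {D : ℕ} (τ : Fin (D + 1) → Perm V) :
    (∀ k, invariants {τ k}) →ₗ[ZMod 2] (V → ZMod 2) where
  toFun h := ∑ k, (h k).1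
  map_add' f g := by simp [Finset.sum_add_distrib]
  map_smul' a f := by simp [Finset.smul_sum]

theorem edgeBoundary_apply {V : Type} {D : ℕ} (τ : Fin (D + 1) → Perm V)
    (h : ∀ k, invariants {τ k}) (x : V) : edgeBoundary τ h x = ∑ k, (h k).1 x := by
  simp [edgeBoundary]

theorem range_faceBoundary_le {V : Type} {D : ℕ} (τ : Fin (D + 1) → Perm V) :
    LinearMap.range (faceBoundary τ) ≤ LinearMap.ker (edgeBoundary τ) := by
  rintro _ ⟨g, rfl⟩
  rw [LinearMap.mem_ker]
  ext x
  rw [edgeBoundary_apply]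
  simp only [faceBoundary, LinearMap.coe_mk, AddHom.coe_mk, Pi.add_apply,
    Finset.sum_add_distrib]
  have h : ∑ k, (g (k - 1)).1 x = ∑ k, (g k).1 x :=
    (Equiv.subRight (1 : Fin (D + 1))).sum_comp (fun k => (g k).1 x)
  rw [h]
  exact CharTwo.add_self_eq_zero _

theorem jacketAcyclic_iff {V : Type} {D : ℕ} (τ : Fin (D + 1) → Perm V) :
    JacketAcyclic τ ↔ LinearMap.range (faceBoundary τ) = LinearMap.ker (edgeBoundary τ) := by
  refine ⟨fun H => le_antisymm (range_faceBoundary_le τ) fun h hh => ?_, fun H h hh hs => ?_⟩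
  · obtain ⟨g, hg₁, hg₂, hg⟩ := H (fun k => (h k).1) (fun k x => (h k).2 _ rfl x)
      (fun x => by rw [← edgeBoundary_apply, LinearMap.mem_ker.1 hh, Pi.zero_apply])
    refine ⟨fun k => ⟨g k, ?_⟩, ?_⟩
    · rintro _ (rfl | rfl) x
      exacts [hg₁ k x, hg₂ k x]
    · ext k x
      have := hg (k - 1) x
      rw [sub_add_cancel] at this
      exact this.symm
  · have hmem : (fun k => ⟨h k, by rintro _ rfl x; exact hh k x⟩ : ∀ k, invariants {τ k}) ∈
        LinearMap.ker (edgeBoundary τ) := by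
      rw [LinearMap.mem_ker]
      ext x
      rw [edgeBoundary_apply]
      exact hs x
    rw [← H] at hmem
    obtain ⟨g, hg⟩ := hmem
    refine ⟨fun k => (g k).1, fun k x => (g k).2 _ (by simp) x, fun k x => (g k).2 _ (by simp) x,
      fun k x => ?_⟩
    have := congrFun (congrArg Subtype.val (congrFun hg (k + 1))) x
    simp only [faceBoundary, LinearMap.coe_mk, AddHom.coe_mk, Pi.add_apply] at this
    rw [add_sub_cancel_right] at this
    exact this.symm

theorem eq_apply_zero_of_forall_succ {D : ℕ} {α : Type} {f : Fin (D + 1) → α}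
    (h : ∀ k, f (k + 1) = f k) (k : Fin (D + 1)) : f k = f 0 := by
  induction k using Fin.induction with
  | zero => rfl
  | succ k ih => rw [← ih, ← h k.castSucc, Fin.coeSucc_eq_succ]

theorem finrank_ker_faceBoundary {V : Type} [Nonempty V] {D : ℕ}
    {τ : Fin (D + 1) → Perm V} (hτ : IsConnectedColoring τ) :
    Module.finrank (ZMod 2) (LinearMap.ker (faceBoundary τ)) = 1 := by
  obtain ⟨x₀⟩ := ‹Nonempty V›
  let c : ∀ k, invariants {τ k, τ (k + 1)} := fun k => ⟨fun _ => 1, fun _ _ _ => rfl⟩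
  have hc : c ∈ LinearMap.ker (faceBoundary τ) := by
    rw [LinearMap.mem_ker]
    ext k x
    exact CharTwo.add_self_eq_zero (1 : ZMod 2)
  refine finrank_eq_one (⟨c, hc⟩ : LinearMap.ker (faceBoundary τ)) ?_ ?_
  · intro h
    have := congrFun (congrArg Subtype.val (congrFun (congrArg Subtype.val h) 0)) x₀
    exact one_ne_zero this
  · rintro ⟨g, hg⟩
    rw [LinearMap.mem_ker] at hg
    have h₁ (k x) : (g (k + 1)).1 x = (g k).1 x := by
      have := congrFun (congrArg Subtype.val (congrFun hg (k + 1))) x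
      simp only [faceBoundary, LinearMap.coe_mk, AddHom.coe_mk, Pi.add_apply] at this
      rw [add_sub_cancel_right] at this
      exact CharTwo.add_eq_zero.1 this
    have h₂ (k x) : (g k).1 x = (g 0).1 x :=
      eq_apply_zero_of_forall_succ (f := fun k => (g k).1 x) (fun k => h₁ k x) k
    have h₃ (x) : (g 0).1 x = (g 0).1 x₀ := by
      refine hτ.conn (fun y => (g 0).1 y = (g 0).1 x₀) (fun k y hy => ?_) x₀ x rfl
      rw [← hy, ← h₂ k, (g k).2 _ (by simp), h₂]
    refine ⟨(g 0).1 x₀, ?_⟩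
    ext k x
    simp [c, h₂ k, h₃ x]

/-- The sum of the coefficients of a `0`-chain. -/
def augmentation (V : Type) [Fintype V] : (V → ZMod 2) →ₗ[ZMod 2] ZMod 2 where
  toFun f := ∑ x, f x
  map_add' f g := by simp [Finset.sum_add_distrib]
  map_smul' a f := by simp [Finset.mul_sum]

theorem sum_eq_zero_of_invariant {V : Type} [Fintype V] {s : Perm V} (hs : ∀ x, s (s x) = x)
    (hsf : ∀ x, s x ≠ x) {f : V → ZMod 2} (hf : ∀ x, f (s x) = f x) : ∑ x, f x = 0 :=
  Finset.sum_involution (fun x _ => s x)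
    (fun x _ => by rw [hf]; exact CharTwo.add_self_eq_zero _) (fun x _ _ => hsf x)
    (fun _ _ => Finset.mem_univ _) (fun x _ => hs x)

theorem range_edgeBoundary {V : Type} [Fintype V] [Nonempty V] {D : ℕ}
    {τ : Fin (D + 1) → Perm V} (hτ : IsConnectedColoring τ) :
    LinearMap.range (edgeBoundary τ) = LinearMap.ker (augmentation V) := by
  classical
  obtain ⟨x₀⟩ := ‹Nonempty V›
  refine le_antisymm ?_ ?_
  · rintro _ ⟨h, rfl⟩
    rw [LinearMap.mem_ker]
    change ∑ x, edgeBoundary τ h x = 0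
    simp only [edgeBoundary_apply]
    rw [Finset.sum_comm]
    exact Finset.sum_eq_zero fun k _ => sum_eq_zero_of_invariant (hτ.invol k) (hτ.ne_self k)
      ((h k).2 _ rfl)
  · have hpair (x : V) : Pi.single x₀ 1 + Pi.single x 1 ∈ LinearMap.range (edgeBoundary τ) := by
      refine hτ.conn (fun x => Pi.single x₀ 1 + Pi.single x 1 ∈ LinearMap.range (edgeBoundary τ))
        (fun k x hx => ?_) x₀ x ?_
      · have hedge : Pi.single x 1 + Pi.single (τ k x) 1 ∈ LinearMap.range (edgeBoundary τ) := by
          refine ⟨Pi.single k ⟨Pi.single x 1 + Pi.single (τ k x) 1, ?_⟩, ?_⟩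
          · rintro _ rfl y
            have h₁ : τ k y = x ↔ y = τ k x := by
              rw [← (τ k).apply_eq_iff_eq (x := y) (y := τ k x), hτ.invol]
            simp only [Pi.add_apply, Pi.single_apply, h₁, (τ k).apply_eq_iff_eq]
            exact add_comm _ _
          · ext y
            rw [edgeBoundary_apply, Finset.sum_eq_single k]
            · simp
            · intro j _ hj
              simp [hj]
            · simp
        have := add_mem hx hedge
        rwa [add_assoc, ← add_assoc (Pi.single x 1), CharTwo.add_self_eq_zero, zero_add] at this
      · rw [CharTwo.add_self_eq_zero]
        exact zero_mem _
    intro f hf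
    have hf' : ∑ x, f x = 0 := hf
    have : f = ∑ x, f x • (Pi.single x₀ 1 + Pi.single x 1) := by
      ext y
      simp [Finset.sum_add_distrib, hf', Pi.single_apply]
    rw [this]
    exact sum_mem fun x _ => Submodule.smul_mem _ _ (hpair x)

theorem finrank_ker_augmentation (V : Type) [Fintype V] [Nonempty V] :
    Module.finrank (ZMod 2) (LinearMap.ker (augmentation V)) + 1 = Fintype.card V := by
  classical
  obtain ⟨x₀⟩ := ‹Nonempty V›
  have hsurj : LinearMap.range (augmentation V) = ⊤ :=
    LinearMap.range_eq_top.2 fun a => ⟨Pi.single x₀ a, by simp [augmentation]⟩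
  have := (augmentation V).finrank_range_add_finrank_ker
  rw [hsurj, finrank_top, Module.finrank_self, Module.finrank_fintype_fun_eq_card] at this
  omega

/-- Euler's relation for the cellular complex of a jacket. -/
theorem euler_relation {V : Type} [Fintype V] [Nonempty V] {D : ℕ}
    {τ : Fin (D + 1) → Perm V} (hτ : IsConnectedColoring τ) :
    2 * ∑ k, orbitCount {τ k, τ (k + 1)} + 2 * Fintype.card V +
        2 * Module.finrank (ZMod 2) (LinearMap.ker (edgeBoundary τ)) =
      4 + (D + 1) * Fintype.card V +
        2 * Module.finrank (ZMod 2) (LinearMap.range (faceBoundary τ)) := by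
  have h₁ := (faceBoundary τ).finrank_range_add_finrank_ker
  rw [finrank_ker_faceBoundary hτ, Module.finrank_pi_fintype] at h₁
  have h₂ := (edgeBoundary τ).finrank_range_add_finrank_ker
  rw [range_edgeBoundary hτ, Module.finrank_pi_fintype] at h₂
  simp only [finrank_invariants] at h₁ h₂
  have h₃ := finrank_ker_augmentation V
  have h₄ : (D + 1) * Fintype.card V = 2 * ∑ k, orbitCount {τ k} := by
    rw [Finset.mul_sum, ← Finset.sum_congr rfl fun k _ =>
      card_eq_two_mul_orbitCount (τ k) (hτ.invol k) (hτ.ne_self k)]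
    simp
  omega

theorem two_mul_sum_orbitCount_le {V : Type} [Fintype V] [Nonempty V] {D : ℕ}
    {τ : Fin (D + 1) → Perm V} (hτ : IsConnectedColoring τ) :
    2 * ∑ k, orbitCount {τ k, τ (k + 1)} + 2 * Fintype.card V ≤
      4 + (D + 1) * Fintype.card V := by
  have h₁ := euler_relation hτ
  have h₂ := Submodule.finrank_mono (range_faceBoundary_le τ)
  omega

theorem jacketAcyclic_iff_sum_orbitCount {V : Type} [Fintype V] [Nonempty V] {D : ℕ}
    {τ : Fin (D + 1) → Perm V} (hτ : IsConnectedColoring τ) :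
    JacketAcyclic τ ↔ 2 * ∑ k, orbitCount {τ k, τ (k + 1)} + 2 * Fintype.card V =
      4 + (D + 1) * Fintype.card V := by
  have h₁ := euler_relation hτ
  rw [jacketAcyclic_iff]
  constructor
  · intro h
    rw [h] at h₁
    omega
  · intro h
    exact Submodule.eq_of_le_of_finrank_eq (range_faceBoundary_le τ) (by omega)

/-- `K` is a set of vertices not containing `v`, `w`, linked to the rest of the graph only by the
edges of color `c` at `v` and `w`. -/
structure IsInsertion {V : Type} {n : ℕ} (σ : Fin n → Perm V) (c : Fin n) (v w : V)
    (K : Set V) : Prop where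
  left_notMem : v ∉ K
  right_notMem : w ∉ K
  left_mem : σ c v ∈ K
  right_mem : σ c w ∈ K
  closed : ∀ d, ∀ u ∈ K, σ d u ∈ K ∨ d = c ∧ (u = σ c v ∨ u = σ c w)

theorem exists_perm_of_injective {α : Type} {n : ℕ} {x y : Fin n → α}
    (hx : Function.Injective x) (hy : Function.Injective y) : ∃ π : Perm α, ∀ k, π (x k) = y k := by
  obtain ⟨π, hπ⟩ := (Equiv.Perm.isMultiplyPretransitive α n).exists_smul_eq ⟨x, hx⟩ ⟨y, hy⟩
  exact ⟨π, fun k => DFunLike.congr_fun hπ k⟩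

/-- A two-colored face with two vertices separates the remaining half-edges of distinct colors. -/
theorem exists_isInsertion {V : Type} {D : ℕ} (hD : 3 ≤ D) {σ : Fin (D + 1) → Perm V}
    (hσ : IsConnectedColoring σ) (hacyc : ∀ π : Perm (Fin (D + 1)), JacketAcyclic fun k => σ (π k))
    {v w : V} {i j c : Fin (D + 1)} (hij : i ≠ j) (hi : σ i v = w) (hj : σ j v = w)
    (hc : σ c v ≠ w) : ∃ K, IsInsertion σ c v w K := by
  classical
  have hci : c ≠ i := fun h => hc (h ▸ hi)
  have hcj : c ≠ j := fun h => hc (h ▸ hj)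
  have hvw : v ≠ w := hi ▸ (hσ.ne_self i v).symm
  have hi' : σ i w = v := by rw [← hi, hσ.invol]
  have hj' : σ j w = v := by rw [← hj, hσ.invol]
  have hc' : σ c w ≠ v := fun h => hc (by rw [← h, hσ.invol])
  let z : Fin (D + 1) := 0
  let o : Fin (D + 1) := ⟨1, by omega⟩
  let t : Fin (D + 1) := ⟨2, by omega⟩
  have hzo : z ≠ o := by simp [z, o, Fin.ext_iff]
  have hzt : z ≠ t := by simp [z, t, Fin.ext_iff]
  have hot : o ≠ t := by simp [o, t, Fin.ext_iff]
  obtain ⟨π, hπ⟩ := exists_perm_of_injective (x := ![z, o, t]) (y := ![i, c, j])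
    (by intro a b; fin_cases a <;> fin_cases b <;> simp [hzo, hzt, hot, hzo.symm, hzt.symm, hot.symm])
    (by intro a b; fin_cases a <;> fin_cases b <;> simp [hci, hcj, hij, hci.symm, hcj.symm, hij.symm])
  have hπz : π z = i := hπ 0
  have hπo : π o = c := hπ 1
  have hπt : π t = j := hπ 2
  obtain ⟨g, hg₁, -, hg⟩ := hacyc π
    (fun k x => if (x = v ∨ x = w) ∧ (k = z ∨ k = t) then 1 else 0) (by
      intro k x
      have : (k = z ∨ k = t) → ((σ (π k) x = v ∨ σ (π k) x = w) ↔ (x = v ∨ x = w)) := by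
        have key (d) (h₁ : σ d v = w) (h₂ : σ d w = v) :
            ((σ d x = v ∨ σ d x = w) ↔ (x = v ∨ x = w)) := by
          constructor
          · rintro (h | h)
            · right; rw [← h₁, ← h, hσ.invol]
            · left; rw [← h₂, ← h, hσ.invol]
          · rintro (rfl | rfl)
            · exact Or.inr h₁
            · exact Or.inl h₂
        rintro (rfl | rfl)
        · rw [hπz]; exact key i hi hi'
        · rw [hπt]; exact key j hj hj'
      refine if_congr ?_ rfl rfl
      tauto) (by
      intro x
      by_cases hx : x = v ∨ x = w
      · simp only [hx, true_and]
        rw [Finset.sum_ite, Finset.sum_const_zero, add_zero]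
        have : (Finset.univ.filter fun k => k = z ∨ k = t) = {z, t} := by ext; simp
        rw [this, Finset.sum_pair hzt]
        rfl
      · simp [hx])
  have hout (x) (hx : ¬(x = v ∨ x = w)) (k) : g k x = g z x := by
    refine eq_apply_zero_of_forall_succ (f := fun k => g k x) (fun k => ?_) k
    have := hg k x
    simp only [hx, false_and, if_false] at this
    exact CharTwo.add_eq_zero.1 this.symm
  have hin (x) (hx : x = v ∨ x = w) (k) : g k x = g z x + if k = z ∨ k = o then 0 else 1 := by
    induction k using Fin.induction with
    | zero => simp [z]
    | succ k ih =>
      have := hg k.castSucc x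
      rw [Fin.coeSucc_eq_succ, ih] at this
      simp only [hx, true_and] at this
      have h₁ : g k.succ x = g z x + (if k.castSucc = z ∨ k.castSucc = o then 0 else 1) +
          (if k.succ = z ∨ k.succ = t then 1 else 0) := by
        rw [this, add_comm (g k.succ x), ← add_assoc, CharTwo.add_self_eq_zero, zero_add]
      rw [h₁, add_assoc]
      congr 1
      simp only [z, o, t, Fin.ext_iff, Fin.val_succ, Fin.val_castSucc, Fin.val_zero]
      rcases Nat.lt_trichotomy k.val 1 with h | h | h
      · have : k.val = 0 := by omega
        simp [this]
      · simp [h]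
      · have h₁ : ¬ (k.val = 0 ∨ k.val = 1) := by omega
        have h₂ : ¬ (k.val + 1 = 0 ∨ k.val + 1 = 2) := by omega
        have h₃ : ¬ (k.val + 1 = 0 ∨ k.val + 1 = 1) := by omega
        rw [if_neg h₁, if_neg h₂, if_neg h₃, add_zero]
  have hwv : g z w = g z v := by
    rw [← hg₁ z v]
    simp [hπz, hi]
  have hone (x) (hx : x = v ∨ x = w) : g o x = g z v := by
    rw [hin x hx o, if_pos (Or.inr rfl), add_zero]
    rcases hx with rfl | rfl
    exacts [rfl, hwv]
  have hfar (x) (hx : x = v ∨ x = w) (k) (hkz : k ≠ z) (hko : k ≠ o) : g k x ≠ g z v := by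
    rw [hin x hx k, if_neg (by tauto)]
    have : g z x = g z v := by
      rcases hx with rfl | rfl
      exacts [rfl, hwv]
    rw [this]
    simp
  have hmem (x) (hx : x = v ∨ x = w) : ¬(σ c x = v ∨ σ c x = w) ∧ g z (σ c x) = g z v := by
    have h₁ : ¬(σ c x = v ∨ σ c x = w) := by
      rcases hx with rfl | rfl
      · simp [hσ.ne_self, hc]
      · simp [hσ.ne_self, hc']
    refine ⟨h₁, ?_⟩
    have := hg₁ o x
    simp only [hπo] at this
    rw [← hout _ h₁ o, this, hone x hx]
  refine ⟨{x | ¬(x = v ∨ x = w) ∧ g z x = g z v}, by simp, by simp, hmem v (Or.inl rfl),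
    hmem w (Or.inr rfl), ?_⟩
  rintro d u ⟨hu, hgu⟩
  obtain ⟨k, rfl⟩ := π.surjective d
  by_cases hd : σ (π k) u = v ∨ σ (π k) u = w
  · right
    have hu' : u = σ (π k) (σ (π k) u) := (hσ.invol _ _).symm
    have hko : k = o := by
      by_contra hko
      by_cases hkz : k = z
      · rw [hkz, hπz] at hd hu'
        rcases hd with h | h <;> rw [h] at hu'
        exacts [hu (Or.inr (hu'.trans hi)), hu (Or.inl (hu'.trans hi'))]
      · refine hfar _ hd k hkz hko ?_
        rw [hg₁ k u, hout u hu, hgu]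
    rw [hko, hπo] at hd hu' ⊢
    refine ⟨rfl, ?_⟩
    exact hd.imp (fun h => hu'.trans (congrArg _ h)) fun h => hu'.trans (congrArg _ h)
  · left
    refine ⟨hd, ?_⟩
    rw [← hout _ hd k, hg₁ k u, hout u hu, hgu]

namespace IsInsertion

open Classical in
/-- Cut the edges from an insertion `K` to `v` and `w`, and join their ends in `K`. -/
noncomputable def closingFun {V : Type} {n : ℕ} {σ : Fin n → Perm V} {c : Fin n} {v w : V}
    {K : Set V} (hK : IsInsertion σ c v w K) (d : Fin n) (u : K) : K :=
  if h : σ d u ∈ K then ⟨σ d u, h⟩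
  else if u = σ c v then ⟨σ c w, hK.right_mem⟩ else ⟨σ c v, hK.left_mem⟩

section

variable {V : Type} {n : ℕ} {σ : Fin n → Perm V} {c : Fin n} {v w : V} {K : Set V}

theorem ne (hK : IsInsertion σ c v w K) {i : Fin n} (hi : σ i v = w) : i ≠ c :=
  fun h => hK.right_notMem (hi ▸ h ▸ hK.left_mem)

theorem closingFun_of_mem (hK : IsInsertion σ c v w K) {d : Fin n} {u : K} (h : σ d u ∈ K) :
    (hK.closingFun d u : V) = σ d u := by
  rw [closingFun, dif_pos h]

theorem closingFun_left (hσ : IsConnectedColoring σ) (hK : IsInsertion σ c v w K) :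
    hK.closingFun c ⟨σ c v, hK.left_mem⟩ = ⟨σ c w, hK.right_mem⟩ := by
  rw [closingFun, dif_neg (by simp [hσ.invol, hK.left_notMem]), if_pos rfl]

theorem closingFun_right (hσ : IsConnectedColoring σ) (hK : IsInsertion σ c v w K) (hvw : v ≠ w) :
    hK.closingFun c ⟨σ c w, hK.right_mem⟩ = ⟨σ c v, hK.left_mem⟩ := by
  rw [closingFun, dif_neg (by simp [hσ.invol, hK.right_notMem]), if_neg (by simp [hvw.symm])]

/-- The three possible positions of an edge of color `d` at `u ∈ K`. -/
theorem edge_cases (hK : IsInsertion σ c v w K) (d : Fin n) (u : K) :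
    σ d u ∈ K ∨ (d = c ∧ u = ⟨σ c v, hK.left_mem⟩) ∨ (d = c ∧ u = ⟨σ c w, hK.right_mem⟩) := by
  rcases hK.closed d u u.2 with h | ⟨h, h' | h'⟩
  · exact Or.inl h
  · exact Or.inr (Or.inl ⟨h, Subtype.ext h'⟩)
  · exact Or.inr (Or.inr ⟨h, Subtype.ext h'⟩)

theorem closingFun_involutive (hσ : IsConnectedColoring σ) (hK : IsInsertion σ c v w K)
    (hvw : v ≠ w) (d : Fin n) : Function.Involutive (hK.closingFun d) := by
  intro u
  rcases hK.edge_cases d u with h | ⟨rfl, rfl⟩ | ⟨rfl, rfl⟩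
  · have h₁ : hK.closingFun d u = ⟨σ d u, h⟩ := Subtype.ext (hK.closingFun_of_mem h)
    rw [h₁]
    refine Subtype.ext ?_
    rw [hK.closingFun_of_mem (by simp [hσ.invol])]
    exact hσ.invol _ _
  · rw [hK.closingFun_left hσ, hK.closingFun_right hσ hvw]
  · rw [hK.closingFun_right hσ hvw, hK.closingFun_left hσ]

/-- The closed graph on an insertion. -/
noncomputable def closing (hσ : IsConnectedColoring σ) (hK : IsInsertion σ c v w K)
    (hvw : v ≠ w) (d : Fin n) : Perm K :=
  (hK.closingFun_involutive hσ hvw d).toPerm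

theorem closing_of_mem (hσ : IsConnectedColoring σ) (hK : IsInsertion σ c v w K) (hvw : v ≠ w)
    {d : Fin n} {u : K} (h : σ d u ∈ K) : (hK.closing hσ hvw d u : V) = σ d u :=
  hK.closingFun_of_mem h

theorem closing_left (hσ : IsConnectedColoring σ) (hK : IsInsertion σ c v w K) (hvw : v ≠ w) :
    hK.closing hσ hvw c ⟨σ c v, hK.left_mem⟩ = ⟨σ c w, hK.right_mem⟩ :=
  hK.closingFun_left hσ

theorem closing_right (hσ : IsConnectedColoring σ) (hK : IsInsertion σ c v w K) (hvw : v ≠ w) :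
    hK.closing hσ hvw c ⟨σ c w, hK.right_mem⟩ = ⟨σ c v, hK.left_mem⟩ :=
  hK.closingFun_right hσ hvw

/-- Invariance under the closed graph, in terms of the original one. -/
theorem apply_closing_eq {α : Type} (hσ : IsConnectedColoring σ) (hK : IsInsertion σ c v w K)
    (hvw : v ≠ w) {f : V → α} {d : Fin n} (hf : ∀ x, f (σ d x) = f x) (hfvw : f v = f w)
    (u : K) : f (hK.closing hσ hvw d u) = f u := by
  rcases hK.edge_cases d u with h | ⟨rfl, rfl⟩ | ⟨rfl, rfl⟩
  · rw [hK.closing_of_mem hσ hvw h, hf]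
  · rw [closing_left]
    simp [hf, hfvw]
  · rw [closing_right]
    simp [hf, hfvw]

theorem closing_isConnectedColoring (hσ : IsConnectedColoring σ) (hK : IsInsertion σ c v w K)
    (hvw : v ≠ w) : IsConnectedColoring (hK.closing hσ hvw) where
  invol d u := hK.closingFun_involutive hσ hvw d u
  ne_self d u := by
    rcases hK.edge_cases d u with h | ⟨rfl, rfl⟩ | ⟨rfl, rfl⟩
    · intro h'
      exact hσ.ne_self d u (by rw [← hK.closing_of_mem hσ hvw h, h'])
    · rw [closing_left]
      simp [hvw.symm]
    · rw [closing_right]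
      simp [hvw]
  conn P hP x y hx := by
    classical
    let p : K := ⟨σ c v, hK.left_mem⟩
    let q : K := ⟨σ c w, hK.right_mem⟩
    have hpq : P p ↔ P q := by
      constructor
      · intro h
        have := hP c _ h
        rwa [closing_left] at this
      · intro h
        have := hP c _ h
        rwa [closing_right] at this
    let Q : V → Prop := fun z => if h : z ∈ K then P ⟨z, h⟩ else P p
    have hQ (z : K) : Q z ↔ P z := by simp [Q]
    have hQ' (z) (hz : z ∉ K) : Q z ↔ P p := by simp [Q, hz]
    have hstep (d) (u : K) (hu : σ d u ∉ K) : P u ↔ P p := by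
      rcases hK.edge_cases d u with h | ⟨rfl, rfl⟩ | ⟨rfl, rfl⟩
      · exact absurd h hu
      · rfl
      · exact hpq.symm
    refine (hQ y).1 (hσ.conn Q (fun d z hz => ?_) x y ((hQ x).2 hx))
    by_cases hzK : z ∈ K <;> by_cases hdK : σ d z ∈ K
    · have h₁ : hK.closing hσ hvw d ⟨z, hzK⟩ = ⟨σ d z, hdK⟩ :=
        Subtype.ext (hK.closing_of_mem hσ hvw hdK)
      rw [hQ ⟨z, hzK⟩] at hz
      rw [hQ ⟨σ d z, hdK⟩, ← h₁]
      exact hP d _ hz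
    · rw [hQ ⟨z, hzK⟩] at hz
      rw [hQ' _ hdK]
      exact (hstep d ⟨z, hzK⟩ hdK).1 hz
    · rw [hQ' _ hzK] at hz
      rw [hQ ⟨σ d z, hdK⟩]
      exact (hstep d ⟨σ d z, hdK⟩ (by simpa [hσ.invol] using hzK)).2 hz
    · rwa [hQ' _ hdK, ← hQ' _ hzK]

end

theorem closing_jacketAcyclic {V : Type} {D : ℕ} {σ : Fin (D + 1) → Perm V} {c i : Fin (D + 1)}
    {v w : V} {K : Set V} (hσ : IsConnectedColoring σ) (hK : IsInsertion σ c v w K)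
    (hvw : v ≠ w) (hi : σ i v = w) (π : Perm (Fin (D + 1)))
    (hacyc : JacketAcyclic fun k => σ (π k)) :
    JacketAcyclic fun k => hK.closing hσ hvw (π k) := by
  classical
  intro h hh hs
  have hi' : σ i w = v := by rw [← hi, hσ.invol]
  have hic := hK.ne hi
  let t := h (π.symm c) ⟨σ c v, hK.left_mem⟩
  have ht : h (π.symm c) ⟨σ c w, hK.right_mem⟩ = t := by
    have := hh (π.symm c) ⟨σ c v, hK.left_mem⟩
    simp only [apply_symm_apply] at this
    rwa [closing_left] at this
  let H : Fin (D + 1) → V → ZMod 2 := fun k x =>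
    if hx : x ∈ K then h k ⟨x, hx⟩
    else if (x = v ∨ x = w) ∧ (π k = c ∨ π k = i) then t else 0
  have hHK (k) (x : K) : H k x = h k x := by simp [H]
  have hHvw (x) (hx : x = v ∨ x = w) (k) : H k x = if π k = c ∨ π k = i then t else 0 := by
    have hxK : x ∉ K := by
      rcases hx with rfl | rfl
      exacts [hK.left_notMem, hK.right_notMem]
    simp [H, hx, hxK]
  have hHout (x) (hxK : x ∉ K) (hx : ¬(x = v ∨ x = w)) (k) : H k x = 0 := by simp [H, hx, hxK]
  have hHinvK (k) (x : K) : H k (σ (π k) x) = H k x := by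
    have hk' (hk : π k = c) : π.symm c = k := by rw [← hk, symm_apply_apply]
    rcases hK.edge_cases (π k) x with hk | ⟨hk, rfl⟩ | ⟨hk, rfl⟩
    · have := hh k x
      rw [← hHK, ← hHK, hK.closing_of_mem hσ hvw hk] at this
      exact this
    · rw [hHK, hk, hσ.invol, hHvw v (Or.inl rfl), if_pos (Or.inl hk), ← hk' hk]
    · rw [hHK, hk, hσ.invol, hHvw w (Or.inr rfl), if_pos (Or.inl hk), ← ht, hk' hk]
  have hHinv (k) (x) : H k (σ (π k) x) = H k x := by
    by_cases hxK : x ∈ K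
    · exact hHinvK k ⟨x, hxK⟩
    by_cases hdK : σ (π k) x ∈ K
    · have := hHinvK k ⟨_, hdK⟩
      rw [hσ.invol] at this
      exact this.symm
    have hkc (hx : x = v ∨ x = w) : π k ≠ c := by
      rintro hk
      rw [hk] at hdK
      rcases hx with rfl | rfl
      exacts [hdK hK.left_mem, hdK hK.right_mem]
    have hkc' (hx : σ (π k) x = v ∨ σ (π k) x = w) : π k ≠ c := by
      rintro hk
      rw [hk] at hx
      rcases hx with hx | hx
      · exact hxK (by rw [← hσ.invol c x, hx]; exact hK.left_mem)
      · exact hxK (by rw [← hσ.invol c x, hx]; exact hK.right_mem)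
    by_cases hki : π k = i
    · have h₁ : (σ (π k) x = v ∨ σ (π k) x = w) ↔ (x = v ∨ x = w) := by
        rw [hki]
        constructor
        · rintro (h | h)
          · right; rw [← hi, ← h, hσ.invol]
          · left; rw [← hi', ← h, hσ.invol]
        · rintro (rfl | rfl)
          · exact Or.inr hi
          · exact Or.inl hi'
      simp only [H, hxK, hdK, dif_neg, not_false_eq_true, h₁]
    · simp only [H, hxK, hdK, dif_neg, not_false_eq_true]
      rw [if_neg (by tauto), if_neg (by tauto)]
  obtain ⟨g, hg₁, hg₂, hg⟩ := hacyc H hHinv (by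
    intro x
    by_cases hxK : x ∈ K
    · simpa only [← hHK] using hs ⟨x, hxK⟩
    by_cases hx : x = v ∨ x = w
    · simp only [hHvw x hx]
      rw [Equiv.sum_comp π (fun d => if d = c ∨ d = i then t else 0), Finset.sum_ite,
        Finset.sum_const_zero, add_zero]
      have : (Finset.univ.filter fun k => k = c ∨ k = i) = {c, i} := by ext; simp
      rw [this, Finset.sum_pair hic.symm]
      exact CharTwo.add_self_eq_zero _
    · simp [hHout x hxK hx])
  have hgvw (k) : g k v = g k w := by
    have h₁ (k) : g k v + g k w = g 0 v + g 0 w := by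
      refine eq_apply_zero_of_forall_succ (f := fun k => g k v + g k w) (fun k => ?_) k
      have hv := hg k v
      have hw := hg k w
      rw [hHvw v (Or.inl rfl)] at hv
      rw [hHvw w (Or.inr rfl), hv] at hw
      have : (g (k + 1) v + g (k + 1) w) + (g k v + g k w) = 0 := by
        rw [add_add_add_comm, hw]
        exact CharTwo.add_self_eq_zero _
      exact CharTwo.add_eq_zero.1 this
    have h₂ : g (π.symm i) w = g (π.symm i) v := by
      have := hg₁ (π.symm i) v
      simpa [hi] using this
    have h₃ := h₁ (π.symm i)
    rw [h₂, CharTwo.add_self_eq_zero] at h₃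
    exact CharTwo.add_eq_zero.1 ((h₁ k).trans h₃.symm)
  refine ⟨fun k x => g k x, fun k x => ?_, fun k x => ?_, fun k x => ?_⟩
  · exact hK.apply_closing_eq hσ hvw (hg₁ k) (hgvw k) x
  · exact hK.apply_closing_eq hσ hvw (hg₂ k) (hgvw k) x
  · rw [← hg k x, hHK]

end IsInsertion

theorem exists_apply_eq_apply {V : Type} [Fintype V] [Nonempty V] {D : ℕ} (hD : 3 ≤ D)
    {σ : Fin (D + 1) → Perm V} (hσ : IsConnectedColoring σ) (hacyc : JacketAcyclic σ) :
    ∃ i j v, i ≠ j ∧ σ i v = σ j v := by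
  by_contra! H
  have h₁ := (jacketAcyclic_iff_sum_orbitCount hσ).1 hacyc
  have h₂ : ∑ k, 4 * orbitCount {σ k, σ (k + 1)} ≤ ∑ _k : Fin (D + 1), Fintype.card V := by
    refine Finset.sum_le_sum fun k _ => four_mul_orbitCount_le _ _ (hσ.invol k) (hσ.ne_self k)
      (hσ.ne_self _) fun x => H k (k + 1) x ?_
    have : NeZero D := ⟨by omega⟩
    simp
  rw [← Finset.mul_sum, Finset.sum_const, Finset.card_univ, Fintype.card_fin, smul_eq_mul] at h₂
  have h₃ : 4 * Fintype.card V ≤ (D + 1) * Fintype.card V := Nat.mul_le_mul_right _ (by omega)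
  omega

theorem IsInsertion.disjoint {V : Type} {n : ℕ} {σ : Fin n → Perm V} {c₁ c₂ : Fin n} {v w : V}
    {K₁ K₂ : Set V} (hσ : IsConnectedColoring σ) (h₁ : IsInsertion σ c₁ v w K₁)
    (h₂ : IsInsertion σ c₂ v w K₂) (hc : c₁ ≠ c₂) : Disjoint K₁ K₂ := by
  rw [Set.disjoint_left]
  intro x hx₁ hx₂
  refine h₁.left_notMem (hσ.conn (fun x => x ∈ K₁ ∧ x ∈ K₂) ?_ x v ⟨hx₁, hx₂⟩).1
  rintro d x ⟨hx₁, hx₂⟩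
  rcases h₁.closed d x hx₁ with h | ⟨rfl, h⟩
  · refine ⟨h, (h₂.closed d x hx₂).resolve_right ?_⟩
    rintro ⟨rfl, rfl | rfl⟩
    · exact h₁.left_notMem (by rwa [hσ.invol] at h)
    · exact h₁.right_notMem (by rwa [hσ.invol] at h)
  · exfalso
    have h' := (h₂.closed d x hx₂).resolve_right fun h => hc h.1
    rcases h with rfl | rfl
    · exact h₂.left_notMem (by rwa [hσ.invol] at h')
    · exact h₂.right_notMem (by rwa [hσ.invol] at h')

/-- A graph all of whose jackets are acyclic has `D` parallel edges different from any prescribed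
edge, here the one of color `e` at `x`. -/
theorem exists_parallel_edges_avoiding {D : ℕ} (hD : 3 ≤ D) (N : ℕ) :
    ∀ (V : Type) [Fintype V] [Nonempty V] (σ : Fin (D + 1) → Perm V), Fintype.card V = N →
      IsConnectedColoring σ → (∀ π : Perm (Fin (D + 1)), JacketAcyclic fun k => σ (π k)) →
      ∀ (e : Fin (D + 1)) (x : V), ∃ v w, v ≠ w ∧
        D ≤ Nat.card {i // σ i v = w ∧ ¬(i = e ∧ (v = x ∨ w = x))} := by
  classical
  induction N using Nat.strong_induction_on with
  | _ N ih =>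
  intro V _ _ σ hN hσ hacyc e x
  obtain ⟨i, j, v, hij, hv⟩ := exists_apply_eq_apply hD hσ (hacyc 1)
  obtain ⟨w, hi⟩ : ∃ w, σ i v = w := ⟨_, rfl⟩
  have hj : σ j v = w := hv ▸ hi
  have hvw : v ≠ w := hi ▸ (hσ.ne_self i v).symm
  by_cases hfree : ∃ c K, IsInsertion σ c v w K ∧ x ∉ K ∧ σ e x ∉ K
  · obtain ⟨c, K, hK, hx, -⟩ := hfree
    have : Nonempty K := ⟨⟨_, hK.left_mem⟩⟩
    have hcard : Fintype.card K < N := by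
      rw [← hN]
      exact Fintype.card_subtype_lt hK.left_notMem
    obtain ⟨v', w', hne, hle⟩ := ih _ hcard K (hK.closing hσ hvw) rfl
      (hK.closing_isConnectedColoring hσ hvw)
      (fun π => hK.closing_jacketAcyclic hσ hvw hi π (hacyc π)) c ⟨σ c v, hK.left_mem⟩
    refine ⟨v', w', fun h => hne (Subtype.ext h), hle.trans ?_⟩
    rw [Nat.card_eq_fintype_card, Nat.card_eq_fintype_card]
    refine Fintype.card_subtype_mono _ _ ?_
    rintro d ⟨hd, hdc⟩
    constructor
    · rcases hK.edge_cases d v' with h | ⟨rfl, h⟩ | ⟨rfl, h⟩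
      · rw [← hd, hK.closing_of_mem hσ hvw h]
      · exact absurd ⟨rfl, Or.inl h⟩ hdc
      · refine absurd ⟨rfl, Or.inr ?_⟩ hdc
        rw [← hd, h, hK.closing_right]
    · rintro ⟨-, h | h⟩
      exacts [hx (h ▸ v'.2), hx (h ▸ w'.2)]
  · have htouch (c K) (hK : IsInsertion σ c v w K) : x ∈ K ∨ σ e x ∈ K := by
      by_contra! h
      exact hfree ⟨c, K, hK, h⟩
    refine ⟨v, w, hvw, ?_⟩
    suffices h : ∃ c, ∀ d, d ≠ c → σ d v = w ∧ ¬(d = e ∧ (v = x ∨ w = x)) by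
      obtain ⟨c, hc⟩ := h
      rw [Nat.card_eq_fintype_card]
      refine le_trans ?_ (Fintype.card_subtype_mono (fun d => d ≠ c) _ hc)
      simp
    by_cases hins : ∃ c, σ c v ≠ w
    · obtain ⟨c, hc⟩ := hins
      obtain ⟨K, hK⟩ := exists_isInsertion hD hσ hacyc hij hi hj hc
      refine ⟨c, fun d hdc => ?_⟩
      have hd : σ d v = w := by
        by_contra hd
        obtain ⟨L, hL⟩ := exists_isInsertion hD hσ hacyc hij hi hj hd
        have hKL := Set.disjoint_left.1 (hK.disjoint hσ hL hdc.symm)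
        have key (y) (hy : y ∈ K) (hy' : σ e y ∈ L) : False := by
          rcases hK.closed e y hy with h | ⟨rfl, rfl | rfl⟩
          · exact hKL h hy'
          · exact hL.left_notMem (by rwa [hσ.invol] at hy')
          · exact hL.right_notMem (by rwa [hσ.invol] at hy')
        rcases htouch c K hK with h₁ | h₁ <;> rcases htouch d L hL with h₂ | h₂
        · exact hKL h₁ h₂
        · exact key x h₁ h₂
        · exact key (σ e x) h₁ (by rwa [hσ.invol])
        · exact hKL h₁ h₂
      refine ⟨hd, ?_⟩
      have hd' : σ d w = v := by rw [← hd, hσ.invol]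
      rintro ⟨rfl, rfl | rfl⟩
      · exact (htouch c K hK).elim hK.left_notMem (hd ▸ hK.right_notMem)
      · exact (htouch c K hK).elim hK.right_notMem (hd' ▸ hK.left_notMem)
    · push Not at hins
      exact ⟨e, fun d hd => ⟨hins d, fun h => hd h.1⟩⟩

/-- Averaging over all cyclic orders of the colors. -/
theorem mul_sum_perm_eq {D : ℕ} (hD : 1 ≤ D) (f : Fin (D + 1) → Fin (D + 1) → ℕ) :
    D * ∑ π : Perm (Fin (D + 1)), ∑ k, f (π k) (π (k + 1)) =
      Fintype.card (Perm (Fin (D + 1))) *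
        ∑ ij ∈ Finset.univ.filter (fun ij : Fin (D + 1) × Fin (D + 1) => ij.1 ≠ ij.2),
          f ij.1 ij.2 := by
  have : NeZero D := ⟨by omega⟩
  have hind (k l : Fin (D + 1)) (hkl : k ≠ l) :
      ∑ π : Perm (Fin (D + 1)), f (π k) (π l) = ∑ π : Perm (Fin (D + 1)), f (π 0) (π 1) := by
    obtain ⟨ρ, hρ⟩ := exists_perm_of_injective (x := ![0, 1]) (y := ![k, l])
      (by intro a b; fin_cases a <;> fin_cases b <;> simp)
      (by intro a b; fin_cases a <;> fin_cases b <;> simp [hkl, hkl.symm])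
    rw [← Equiv.sum_comp (Equiv.mulRight ρ) (fun π : Perm (Fin (D + 1)) => f (π 0) (π 1))]
    have h₀ : ρ 0 = k := hρ 0
    have h₁ : ρ 1 = l := hρ 1
    simp [h₀, h₁]
  have hcons : ∑ π : Perm (Fin (D + 1)), ∑ k, f (π k) (π (k + 1)) =
      (D + 1) * ∑ π : Perm (Fin (D + 1)), f (π 0) (π 1) := by
    rw [Finset.sum_comm, Finset.sum_congr rfl fun k _ => hind k (k + 1) (by simp)]
    simp
  have hall : ∑ ij ∈ Finset.univ.filter (fun ij : Fin (D + 1) × Fin (D + 1) => ij.1 ≠ ij.2),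
      ∑ π : Perm (Fin (D + 1)), f (π ij.1) (π ij.2) =
      (D * (D + 1)) * ∑ π : Perm (Fin (D + 1)), f (π 0) (π 1) := by
    rw [Finset.sum_congr rfl fun ij hij => hind _ _ (Finset.mem_filter.1 hij).2]
    have : Finset.univ.filter (fun ij : Fin (D + 1) × Fin (D + 1) => ij.1 ≠ ij.2) =
        Finset.univ.offDiag := by ext; simp
    rw [this, Finset.sum_const, Finset.offDiag_card, smul_eq_mul]
    simp [Nat.add_mul, Nat.mul_add]
  rw [hcons, ← mul_assoc, ← hall, Finset.sum_comm, Finset.sum_congr rfl fun π _ =>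
    Finset.sum_equiv (π.prodCongr π) (t := Finset.univ.filter
      (fun ij : Fin (D + 1) × Fin (D + 1) => ij.1 ≠ ij.2))
      (g := fun ij => f ij.1 ij.2) (by simp) (by simp)]
  simp

theorem IsConnectedColoring.comp_perm {V : Type} {n : ℕ} {σ : Fin n → Perm V}
    (hσ : IsConnectedColoring σ) (π : Perm (Fin n)) : IsConnectedColoring fun k => σ (π k) where
  invol k := hσ.invol (π k)
  ne_self k := hσ.ne_self (π k)
  conn P hP := hσ.conn P fun k x hx => by simpa using hP (π.symm k) x hx

theorem sum_ne_eq_two_mul_sum_lt {n : ℕ} {f : Fin n → Fin n → ℕ} (hf : ∀ i j, f i j = f j i) :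
    ∑ ij ∈ Finset.univ.filter (fun ij : Fin n × Fin n => ij.1 ≠ ij.2), f ij.1 ij.2 =
      2 * ∑ ij ∈ Finset.univ.filter (fun ij : Fin n × Fin n => ij.1 < ij.2), f ij.1 ij.2 := by
  have h : Finset.univ.filter (fun ij : Fin n × Fin n => ij.1 ≠ ij.2) =
      Finset.univ.filter (fun ij : Fin n × Fin n => ij.1 < ij.2) ∪
        Finset.univ.filter (fun ij : Fin n × Fin n => ij.2 < ij.1) := by
    ext ij
    simp [lt_or_lt_iff_ne]
  rw [h, Finset.sum_union, two_mul]
  · congr 1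
    exact Finset.sum_equiv (Equiv.prodComm _ _) (by simp) fun ij _ => hf _ _
  · rw [Finset.disjoint_filter]
    exact fun _ _ h => h.asymm

/-- Vanishing reduced degree forces every jacket to be acyclic. -/
theorem jacketAcyclic_of_sum_orbitCount {V : Type} [Fintype V] [Nonempty V] {D : ℕ} (hD : 1 ≤ D)
    {σ : Fin (D + 1) → Perm V} (hσ : IsConnectedColoring σ)
    (hdeg : 4 * ∑ ij ∈ Finset.univ.filter (fun ij : Fin (D + 1) × Fin (D + 1) => ij.1 < ij.2),
      orbitCount {σ ij.1, σ ij.2} = 4 * D + D * (D - 1) * Fintype.card V)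
    (π : Perm (Fin (D + 1))) : JacketAcyclic fun k => σ (π k) := by
  have havg := mul_sum_perm_eq hD fun i j => orbitCount {σ i, σ j}
  rw [sum_ne_eq_two_mul_sum_lt (f := fun i j => orbitCount {σ i, σ j})
    fun i j => by rw [Set.pair_comm]] at havg
  have hle (π : Perm (Fin (D + 1))) := two_mul_sum_orbitCount_le (hσ.comp_perm π)
  have hsum : ∑ π : Perm (Fin (D + 1)), (2 * ∑ k, orbitCount {σ (π k), σ (π (k + 1))} +
      2 * Fintype.card V) = ∑ _π : Perm (Fin (D + 1)), (4 + (D + 1) * Fintype.card V) := by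
    obtain ⟨m, rfl⟩ : ∃ m, D = m + 1 := ⟨D - 1, by omega⟩
    rw [Nat.add_sub_cancel] at hdeg
    rw [Finset.sum_add_distrib, ← Finset.mul_sum, Finset.sum_const, Finset.sum_const,
      Finset.card_univ, smul_eq_mul, smul_eq_mul]
    refine Nat.eq_of_mul_eq_mul_left (Nat.succ_pos m) ?_
    zify at havg hdeg ⊢
    linear_combination 2 * havg + (Fintype.card (Perm (Fin (m + 1 + 1))) : ℤ) * hdeg
  exact (jacketAcyclic_iff_sum_orbitCount (hσ.comp_perm π)).2
    ((Finset.sum_eq_sum_iff_of_le fun π _ => hle π).1 hsum π (Finset.mem_univ π))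

end ColoredGraph

/-- **A connected edge `(D+1)`-colored graph of reduced degree zero contains `D` parallel
edges.**  For `D ≥ 3`, if the total number of faces `F` of a connected edge
`(D+1)`-colored graph satisfies `4·F = 4·D + D·(D-1)·|V|` (vanishing reduced degree),
then there are two vertices `v ≠ w` joined by at least `D` parallel edges, i.e. the set
of colors `i` with `σ i v = w` has cardinality at least `D`. -/
theorem degree_zero_has_D_parallel_edges
    (D : ℕ) (hD : 3 ≤ D)
    (V : Type) [Fintype V] [Nonempty V]
    (σ : Fin (D + 1) → Equiv.Perm V)
    (hinv : ∀ i, σ i * σ i = 1) (hfpf : ∀ i v, σ i v ≠ v)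
    (hconn : MulAction.IsPretransitive
      (Subgroup.closure (Set.range σ) : Subgroup (Equiv.Perm V)) V)
    (hdeg : 4 * (∑ ij ∈ Finset.univ.filter (fun ij : Fin (D + 1) × Fin (D + 1) => ij.1 < ij.2),
        Nat.card (MulAction.orbitRel.Quotient
          (Subgroup.closure {σ ij.1, σ ij.2} : Subgroup (Equiv.Perm V)) V))
      = 4 * D + D * (D - 1) * Nat.card V) :
    ∃ v w : V, v ≠ w ∧ D ≤ Nat.card {i : Fin (D + 1) // σ i v = w} := by
  have hinv' (k x) : σ k (σ k x) = x := by rw [← Equiv.Perm.mul_apply, hinv, Equiv.Perm.one_apply]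
  have hσ : ColoredGraph.IsConnectedColoring σ := by
    refine ⟨hinv', hfpf, fun P hP x y hx => ?_⟩
    obtain ⟨⟨s, hs⟩, rfl⟩ := hconn.exists_smul_eq x y
    exact ColoredGraph.closure_apply_of_forall (by rintro _ ⟨k, rfl⟩; exact hinv' k)
      (by rintro _ ⟨k, rfl⟩; exact hP k) hs hx
  rw [Nat.card_eq_fintype_card] at hdeg
  obtain ⟨v, w, hvw, h⟩ := ColoredGraph.exists_parallel_edges_avoiding hD _ V σ rfl hσ
    (ColoredGraph.jacketAcyclic_of_sum_orbitCount (by omega) hσ hdeg) 0 (Classical.arbitrary V)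
  exact ⟨v, w, hvw, h.trans (Nat.card_le_card_of_injective _
    (Subtype.impEmbedding _ _ fun _ hi => hi.1).injective)⟩
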